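/- arXiv:1402.4944 — 2 statements merged into one kernel-verified Lean document; each statement's English description precedes it below -/
import Mathlib

section
/- Let X = MD(G, S0, S1, T0, T1) be a strongly connected mixed Cayley digraph that is max-λ but not super-λ, neither a directed cycle nor a cycle, and not in the class F. Let A be a λ-superatom of X with A ∩ X_0 ≠ ∅ and A ∩ X_1 ≠ ∅. Then (1) the vertex set of X is a disjoint union of distinct positive λ-superatoms (and likewise of distinct negative λ-superatoms), and (2) |A ∩ X_0| = |A ∩ X_1|. -/
open Set Pointwise

/-- Arc relation of the mixed Cayley digraph `MD(G,S0,S1,T0,T1)` on vertex set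
`G × Bool`, where `false` plays the role of the index `0` and `true` of `1`. -/
def MDArc {G : Type*} [Group G] (S0 S1 T0 T1 : Set G) (u v : G × Bool) : Prop :=
  (u.2 = false ∧ v.2 = false ∧ ∃ s ∈ S0, v.1 = s * u.1) ∨
  (u.2 = true ∧ v.2 = true ∧ ∃ s ∈ S1, v.1 = s * u.1) ∨
  (u.2 = false ∧ v.2 = true ∧ ∃ t ∈ T0, v.1 = t * u.1) ∨
  (u.2 = true ∧ v.2 = false ∧ ∃ t ∈ T1, u.1 = t * v.1)

/-- A digraph (given by its arc relation) is strongly connected if every vertex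
is reachable from every other vertex by a directed path. -/
def DigraphStronglyConnected {V : Type*} (R : V → V → Prop) : Prop :=
  ∀ u v : V, Relation.ReflTransGen R u v

/-- Out-degree of a vertex: the number of arcs originating at it. -/
noncomputable def outDegree {V : Type*} (R : V → V → Prop) (v : V) : ℕ :=
  {w | R v w}.ncard

/-- In-degree of a vertex: the number of arcs terminating at it. -/
noncomputable def inDegree {V : Type*} (R : V → V → Prop) (v : V) : ℕ :=
  {w | R w v}.ncard

/-- `δ`: the minimum, over all vertices, of in-degrees and out-degrees. -/
noncomputable def minDegree {V : Type*} (R : V → V → Prop) : ℕ :=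
  sInf {n | ∃ v, n = outDegree R v ∨ n = inDegree R v}

/-- `W` is an arc-disconnecting set: a set of arcs whose deletion leaves a
digraph that is not strongly connected. -/
def IsDisconnectingArcSet {V : Type*} (R : V → V → Prop) (W : Set (V × V)) : Prop :=
  (∀ p ∈ W, R p.1 p.2) ∧
  ¬ DigraphStronglyConnected (fun u v => R u v ∧ (u, v) ∉ W)

/-- The arc connectivity `λ`: the minimum cardinality of an arc-disconnecting set. -/
noncomputable def arcConnectivity {V : Type*} (R : V → V → Prop) : ℕ :=
  sInf {n | ∃ W : Set (V × V), IsDisconnectingArcSet R W ∧ W.ncard = n}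

/-- `ω⁺(A)`: the set of arcs from `A` to its complement. -/
def omegaPlus {V : Type*} (R : V → V → Prop) (A : Set V) : Set (V × V) :=
  {p | R p.1 p.2 ∧ p.1 ∈ A ∧ p.2 ∉ A}

/-- `ω⁻(A)`: the set of arcs from the complement of `A` to `A`. -/
def omegaMinus {V : Type*} (R : V → V → Prop) (A : Set V) : Set (V × V) :=
  {p | R p.1 p.2 ∧ p.1 ∉ A ∧ p.2 ∈ A}

/-- A positive arc fragment: a proper nonempty vertex subset with `|ω⁺(A)| = λ`. -/
def IsPosFragment {V : Type*} (R : V → V → Prop) (A : Set V) : Prop :=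
  A.Nonempty ∧ A ≠ Set.univ ∧ (omegaPlus R A).ncard = arcConnectivity R

/-- A negative arc fragment: a proper nonempty vertex subset with `|ω⁻(A)| = λ`. -/
def IsNegFragment {V : Type*} (R : V → V → Prop) (A : Set V) : Prop :=
  A.Nonempty ∧ A ≠ Set.univ ∧ (omegaMinus R A).ncard = arcConnectivity R

/-- An arc fragment: a positive or negative arc fragment. -/
def IsArcFragment {V : Type*} (R : V → V → Prop) (A : Set V) : Prop :=
  IsPosFragment R A ∨ IsNegFragment R A

/-- A `λ`-atom: an arc fragment of least possible cardinality. -/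
def IsLambdaAtom {V : Type*} (R : V → V → Prop) (A : Set V) : Prop :=
  IsArcFragment R A ∧ ∀ B, IsArcFragment R B → A.ncard ≤ B.ncard

/-- A positive `λ`-atom: a positive arc fragment of least possible cardinality
among all arc fragments. -/
def IsPosLambdaAtom {V : Type*} (R : V → V → Prop) (A : Set V) : Prop :=
  IsPosFragment R A ∧ ∀ B, IsArcFragment R B → A.ncard ≤ B.ncard

/-- A negative `λ`-atom: a negative arc fragment of least possible cardinality
among all arc fragments. -/
def IsNegLambdaAtom {V : Type*} (R : V → V → Prop) (A : Set V) : Prop :=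
  IsNegFragment R A ∧ ∀ B, IsArcFragment R B → A.ncard ≤ B.ncard

/-- A `λ`-superatom: an arc fragment with at least two vertices, of least
possible cardinality among arc fragments with at least two vertices. -/
def IsLambdaSuperatom {V : Type*} (R : V → V → Prop) (A : Set V) : Prop :=
  IsArcFragment R A ∧ 2 ≤ A.ncard ∧
    ∀ B, IsArcFragment R B → 2 ≤ B.ncard → A.ncard ≤ B.ncard

/-- A positive `λ`-superatom. -/
def IsPosLambdaSuperatom {V : Type*} (R : V → V → Prop) (A : Set V) : Prop :=
  IsPosFragment R A ∧ 2 ≤ A.ncard ∧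
    ∀ B, IsArcFragment R B → 2 ≤ B.ncard → A.ncard ≤ B.ncard

/-- A negative `λ`-superatom. -/
def IsNegLambdaSuperatom {V : Type*} (R : V → V → Prop) (A : Set V) : Prop :=
  IsNegFragment R A ∧ 2 ≤ A.ncard ∧
    ∀ B, IsArcFragment R B → 2 ≤ B.ncard → A.ncard ≤ B.ncard

/-- The set of out-arcs of a vertex. -/
def outArcsOf {V : Type*} (R : V → V → Prop) (v : V) : Set (V × V) :=
  {p | R p.1 p.2 ∧ p.1 = v}

/-- The set of in-arcs of a vertex. -/
def inArcsOf {V : Type*} (R : V → V → Prop) (v : V) : Set (V × V) :=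
  {p | R p.1 p.2 ∧ p.2 = v}

/-- A digraph is super-`λ` if every minimum arc-disconnecting set is the set of
in-arcs of some vertex or the set of out-arcs of some vertex. -/
def SuperLambda {V : Type*} (R : V → V → Prop) : Prop :=
  ∀ W : Set (V × V), IsDisconnectingArcSet R W → W.ncard = arcConnectivity R →
    (∃ v, W = outArcsOf R v) ∨ (∃ v, W = inArcsOf R v)

/-- The digraph is a directed cycle. -/
def IsDirectedCycleDigraph {V : Type*} (R : V → V → Prop) : Prop :=
  DigraphStronglyConnected R ∧ ∀ v, outDegree R v = 1 ∧ inDegree R v = 1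

/-- The digraph is a cycle: the digraph obtained from an undirected cycle by
replacing each edge with two oppositely oriented arcs. -/
def IsBidirectedCycleDigraph {V : Type*} (R : V → V → Prop) : Prop :=
  DigraphStronglyConnected R ∧ (∀ u v, R u v → R v u) ∧
    ∀ v, outDegree R v = 2 ∧ inDegree R v = 2

/-- The arc relation of the Cayley digraph `Cay(G,S)`. -/
def CayRel {G : Type*} [Group G] (S : Set G) (g h : G) : Prop :=
  ∃ s ∈ S, h = s * g

/-- A digraph is a disjoint union of directed cycles iff every vertex has
out-degree and in-degree one. -/
def IsUnionOfDirectedCycles {V : Type*} (R : V → V → Prop) : Prop :=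
  ∀ v, outDegree R v = 1 ∧ inDegree R v = 1

/-- A digraph is a disjoint union of directed cycles of length two iff every
vertex has out-degree and in-degree one and the arc relation is symmetric. -/
def IsUnionOfTwoCycles {V : Type*} (R : V → V → Prop) : Prop :=
  IsUnionOfDirectedCycles R ∧ ∀ u v, R u v → R v u

/-- The arc relation of the bipartite part `BD(G,T0,T1)` of the mixed Cayley
digraph: the arcs between `X_0` and `X_1`. -/
def BDArc {G : Type*} [Group G] (T0 T1 : Set G) (u v : G × Bool) : Prop :=
  (u.2 = false ∧ v.2 = true ∧ ∃ t ∈ T0, v.1 = t * u.1) ∨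
  (u.2 = true ∧ v.2 = false ∧ ∃ t ∈ T1, u.1 = t * v.1)

/-- The class `F`: one of `Cay(G×{0},S0)`, `Cay(G×{1},S1)` is a disjoint union
of directed cycles, the other is a disjoint union of directed cycles of length
two, and the bipartite part `BD(G,T0,T1)` is a disjoint union of directed
cycles of length two. -/
def InClassF {G : Type*} [Group G] (S0 S1 T0 T1 : Set G) : Prop :=
  ((IsUnionOfDirectedCycles (CayRel S0) ∧ IsUnionOfTwoCycles (CayRel S1)) ∨
   (IsUnionOfDirectedCycles (CayRel S1) ∧ IsUnionOfTwoCycles (CayRel S0))) ∧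
  IsUnionOfTwoCycles (BDArc T0 T1)

namespace MixedCayley

open Finset

/-- Total weight of the arcs from `P` to `Q`. -/
def arcWeight {V : Type*} (r : V → V → ℕ) (P Q : Finset V) : ℕ :=
  ∑ x ∈ P, ∑ y ∈ Q, r x y

/-- Total weight of the arcs leaving `A`. -/
def cutWeight {V : Type*} [Fintype V] [DecidableEq V] (r : V → V → ℕ) (A : Finset V) : ℕ :=
  arcWeight r A Aᶜ

/-- Right translation by `h` on `G × Bool`. -/
def translate {G : Type*} [Group G] (h : G) : G × Bool ≃ G × Bool :=
  (Equiv.mulRight h).prodCongr (Equiv.refl Bool)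

@[simp]
lemma translate_apply {G : Type*} [Group G] (h : G) (x : G × Bool) :
    translate h x = (x.1 * h, x.2) := rfl

@[simp]
lemma translate_symm_apply {G : Type*} [Group G] (h : G) (x : G × Bool) :
    (translate h).symm x = (x.1 * h⁻¹, x.2) := rfl

/-- The vertices of `A` whose second coordinate is `i`. -/
def layer {G : Type*} (A : Finset (G × Bool)) (i : Bool) : Finset (G × Bool) :=
  A.filter (fun x => x.2 = i)

@[simp]
lemma mem_layer {G : Type*} {A : Finset (G × Bool)} {i : Bool} {x : G × Bool} :
    x ∈ layer A i ↔ x ∈ A ∧ x.2 = i := by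
  simp [layer]

section Weights

variable {V : Type*} (r : V → V → ℕ)

lemma arcWeight_swap (P Q : Finset V) :
    arcWeight (fun x y => r y x) P Q = arcWeight r Q P := by
  unfold arcWeight
  exact Finset.sum_comm

lemma arcWeight_mono {P P' Q Q' : Finset V} (hP : P ⊆ P') (hQ : Q ⊆ Q') :
    arcWeight r P Q ≤ arcWeight r P' Q' := by
  unfold arcWeight
  exact (Finset.sum_le_sum fun x _ => Finset.sum_le_sum_of_subset hQ).trans
    (Finset.sum_le_sum_of_subset hP)

variable [Fintype V] [DecidableEq V]

lemma cutWeight_swap (A : Finset V) :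
    cutWeight (fun x y => r y x) A = cutWeight r Aᶜ := by
  unfold cutWeight
  rw [arcWeight_swap, compl_compl]

lemma arcWeight_add_compl_right (P A : Finset V) :
    arcWeight r P A + arcWeight r P Aᶜ = arcWeight r P Finset.univ := by
  unfold arcWeight
  rw [← Finset.sum_add_distrib]
  exact Finset.sum_congr rfl fun x _ => Finset.sum_add_sum_compl A _

lemma arcWeight_add_compl_left (A Q : Finset V) :
    arcWeight r A Q + arcWeight r Aᶜ Q = arcWeight r Finset.univ Q :=
  Finset.sum_add_sum_compl A _

lemma cutWeight_eq_sum (A : Finset V) :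
    cutWeight r A = ∑ x, ∑ y, if x ∈ A ∧ y ∉ A then r x y else 0 := by
  unfold cutWeight arcWeight
  rw [← Finset.sum_filter_add_sum_filter_not Finset.univ (fun x => x ∈ A)]
  rw [Finset.sum_eq_zero (s := univ.filter fun x => x ∉ A), add_zero]
  · refine Finset.sum_congr (by ext; simp) fun x hx => ?_
    have hx' : x ∈ A := by simpa using hx
    rw [← Finset.sum_filter]
    refine Finset.sum_congr ?_ fun _ _ => rfl
    ext y
    simp [hx']
  · intro x hx
    have hx' : x ∉ A := by simpa using hx
    simp [hx']

lemma cutWeight_submodular (A B : Finset V) :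
    cutWeight r (A ∩ B) + cutWeight r (A ∪ B) ≤ cutWeight r A + cutWeight r B := by
  simp only [cutWeight_eq_sum, ← Finset.sum_add_distrib]
  refine Finset.sum_le_sum fun x _ => Finset.sum_le_sum fun y _ => ?_
  by_cases h1 : x ∈ A <;> by_cases h2 : x ∈ B <;> by_cases h3 : y ∈ A <;>
    by_cases h4 : y ∈ B <;> simp [h1, h2, h3, h4]

lemma cutWeight_map (e : V ≃ V) (he : ∀ x y, r (e x) (e y) = r x y) (A : Finset V) :
    cutWeight r (A.map e.toEmbedding) = cutWeight r A := by
  simp only [cutWeight_eq_sum]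
  rw [← Equiv.sum_comp e]
  refine Finset.sum_congr rfl fun x _ => ?_
  rw [← Equiv.sum_comp e]
  refine Finset.sum_congr rfl fun y _ => ?_
  simp [he]

end Weights

section Layers

variable {G : Type*}

lemma disjoint_layer (A : Finset (G × Bool)) (c : Bool) :
    Disjoint (layer A c) (layer A !c) := by
  rw [Finset.disjoint_left]
  intro x hx hx'
  simp_all

lemma layer_union [DecidableEq G] (A : Finset (G × Bool)) (c : Bool) :
    layer A c ∪ layer A (!c) = A := by
  ext x
  by_cases h : x.2 = c
  · simp [h]
  · simp [Bool.eq_not_of_ne h]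

lemma card_layer_add (A : Finset (G × Bool)) (c : Bool) :
    #(layer A c) + #(layer A !c) = #A := by
  classical
  rw [← Finset.card_union_of_disjoint (disjoint_layer A c), layer_union]

lemma sum_layer_add {M : Type*} [AddCommMonoid M] (f : G × Bool → M) (A : Finset (G × Bool))
    (c : Bool) : ∑ x ∈ layer A c, f x + ∑ x ∈ layer A !c, f x = ∑ x ∈ A, f x := by
  classical
  rw [← Finset.sum_union (disjoint_layer A c), layer_union]

lemma sum_layer_univ [Fintype G] (f : G × Bool → ℕ) (i : Bool) :
    ∑ x ∈ layer Finset.univ i, f x = ∑ g : G, f (g, i) := by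
  symm
  refine Finset.sum_bij (fun g _ => (g, i)) (by simp) (by simp) ?_ (by simp)
  rintro ⟨g, j⟩ hb
  simp at hb
  exact ⟨g, by simp, by simp [hb]⟩

variable (r : G × Bool → G × Bool → ℕ)

lemma arcWeight_layer_left (A Q : Finset (G × Bool)) (c : Bool) :
    arcWeight r (layer A c) Q + arcWeight r (layer A !c) Q = arcWeight r A Q :=
  sum_layer_add _ _ _

lemma arcWeight_layer_right (P A : Finset (G × Bool)) (c : Bool) :
    arcWeight r P (layer A c) + arcWeight r P (layer A !c) = arcWeight r P A := by
  unfold arcWeight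
  rw [← Finset.sum_add_distrib]
  exact Finset.sum_congr rfl fun x _ => sum_layer_add _ _ _

end Layers

section Invariant

variable {G : Type*} [Group G] [Fintype G] (r : G × Bool → G × Bool → ℕ)

/-- The weight sent by a vertex of layer `i` to layer `j`. -/
def layerDegree (i j : Bool) : ℕ := ∑ g : G, r (1, i) (g, j)

variable {r}
variable (hr : ∀ (h : G) (x y : G × Bool), r (translate h x) (translate h y) = r x y)

include hr

lemma sum_out (x : G × Bool) (j : Bool) :
    ∑ y ∈ layer Finset.univ j, r x y = layerDegree r x.2 j := by
  rw [sum_layer_univ, layerDegree, ← Equiv.sum_comp (Equiv.mulRight x.1)]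
  refine Finset.sum_congr rfl fun g _ => ?_
  have := hr x.1 (1, x.2) (g, j)
  simpa using this

lemma sum_in (y : G × Bool) (i : Bool) :
    ∑ x ∈ layer Finset.univ i, r x y = layerDegree r i y.2 := by
  rw [sum_layer_univ, layerDegree,
    ← Equiv.sum_comp ((Equiv.inv G).trans (Equiv.mulRight y.1))]
  refine Finset.sum_congr rfl fun g _ => ?_
  have := hr (g⁻¹ * y.1) (1, i) (g, y.2)
  simpa using this

lemma arcWeight_out (A : Finset (G × Bool)) (i j : Bool) :
    arcWeight r (layer A i) (layer Finset.univ j) = #(layer A i) * layerDegree r i j := by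
  unfold arcWeight
  rw [Finset.sum_congr rfl fun x _ => sum_out hr x j, Finset.sum_congr (g := fun _ =>
    layerDegree r i j) rfl, Finset.sum_const, smul_eq_mul]
  intro x hx
  rw [(mem_layer.1 hx).2]

lemma arcWeight_in (A : Finset (G × Bool)) (i j : Bool) :
    arcWeight r (layer Finset.univ i) (layer A j) = #(layer A j) * layerDegree r i j := by
  rw [← arcWeight_swap]
  unfold arcWeight
  rw [Finset.sum_congr rfl fun x _ => sum_in hr x i, Finset.sum_congr (g := fun _ =>
    layerDegree r i j) rfl, Finset.sum_const, smul_eq_mul]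
  intro x hx
  rw [(mem_layer.1 hx).2]

lemma arcWeight_layer_le (A : Finset (G × Bool)) (i j : Bool) :
    arcWeight r (layer A i) (layer A j) ≤ #(layer A j) * layerDegree r i j := by
  rw [← arcWeight_in hr]
  exact arcWeight_mono r (Finset.filter_subset_filter _ (subset_univ _)) subset_rfl

variable [DecidableEq G]

lemma arcWeight_layer_add (A : Finset (G × Bool)) (i j : Bool) :
    arcWeight r (layer A i) (layer A j) + arcWeight r (layer A i) (layer Aᶜ j) =
      #(layer A i) * layerDegree r i j := by
  rw [← arcWeight_out hr]
  unfold arcWeight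
  rw [← Finset.sum_add_distrib]
  refine Finset.sum_congr rfl fun x _ => ?_
  rw [← Finset.sum_union]
  · refine Finset.sum_congr ?_ fun _ _ => rfl
    ext y
    by_cases h : y ∈ A <;> simp [h]
  · rw [Finset.disjoint_left]
    intro y hy hy'
    simp_all

lemma cutWeight_add (A : Finset (G × Bool)) (c : Bool) :
    cutWeight r A + arcWeight r A A =
      #(layer A c) * (layerDegree r c c + layerDegree r c !c) +
      #(layer A !c) * (layerDegree r (!c) c + layerDegree r (!c) !c) := by
  unfold cutWeight
  rw [add_comm, arcWeight_add_compl_right, ← arcWeight_layer_left r A Finset.univ c,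
    ← arcWeight_layer_right r (layer A c) Finset.univ c,
    ← arcWeight_layer_right r (layer A !c) Finset.univ c]
  simp only [arcWeight_out hr]
  ring

lemma cutWeight_compl_add (A : Finset (G × Bool)) (c : Bool) :
    cutWeight r Aᶜ + arcWeight r A A =
      #(layer A c) * (layerDegree r c c + layerDegree r (!c) c) +
      #(layer A !c) * (layerDegree r c (!c) + layerDegree r (!c) !c) := by
  unfold cutWeight
  rw [compl_compl, add_comm, arcWeight_add_compl_left, ← arcWeight_layer_right r Finset.univ A c,
    ← arcWeight_layer_left r Finset.univ (layer A c) c,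
    ← arcWeight_layer_left r Finset.univ (layer A !c) c]
  simp only [arcWeight_in hr]
  ring

lemma cutWeight_map_translate (h : G) (A : Finset (G × Bool)) :
    cutWeight r (A.map (translate h).toEmbedding) = cutWeight r A :=
  cutWeight_map r _ (hr h) A

lemma cutWeight_singleton (hloop : ∀ x, r x x = 0) (w : G × Bool) (c : Bool) :
    cutWeight r {w} = layerDegree r w.2 c + layerDegree r w.2 !c := by
  have h := cutWeight_add hr {w} w.2
  have h1 : layer {w} w.2 = {w} := by ext; simp; grind
  have h2 : layer {w} (!w.2) = ∅ := by ext; simp; grind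
  simp only [h1, h2, arcWeight, Finset.sum_singleton, hloop] at h
  cases c <;> cases hw : w.2 <;> simp_all <;> omega

lemma cutWeight_compl_singleton (hloop : ∀ x, r x x = 0) (w : G × Bool) (c : Bool) :
    cutWeight r {w}ᶜ = layerDegree r c w.2 + layerDegree r (!c) w.2 := by
  have h := cutWeight_compl_add hr {w} w.2
  have h1 : layer {w} w.2 = {w} := by ext; simp; grind
  have h2 : layer {w} (!w.2) = ∅ := by ext; simp; grind
  simp only [h1, h2, arcWeight, Finset.sum_singleton, hloop] at h
  cases c <;> cases hw : w.2 <;> simp_all <;> omega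

lemma layerDegree_le_of_inter_translate (hloop : ∀ x, r x x = 0) {A : Finset (G × Bool)} {h : G}
    {v : G × Bool} (hv : A ∩ A.map (translate h).toEmbedding = {v}) (hh : h ≠ 1) :
    layerDegree r v.2 v.2 ≤ arcWeight r (layer A v.2) (layer Aᶜ v.2) := by
  have hvm : v ∈ A ∩ A.map (translate h).toEmbedding := by simp [hv]
  obtain ⟨hvA, hvB⟩ := Finset.mem_inter.1 hvm
  rw [Finset.mem_map_equiv] at hvB
  set u := (translate h).symm v with hu
  have huv : v ≠ u := by
    intro he
    have := congrArg Prod.fst he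
    simp [hu] at this
    exact hh this
  have hsub : ({v, u} : Finset (G × Bool)) ⊆ layer A v.2 := by
    intro x hx
    simp only [Finset.mem_insert, Finset.mem_singleton] at hx
    rcases hx with rfl | rfl
    · simp [hvA]
    · exact mem_layer.2 ⟨hvB, rfl⟩
  refine le_trans ?_ (arcWeight_mono r hsub subset_rfl)
  unfold arcWeight
  rw [Finset.sum_pair huv, ← sum_out hr v v.2]
  have e1 : ∑ y ∈ layer Aᶜ v.2, r v y =
      ∑ y ∈ layer Finset.univ v.2, if y ∉ A then r v y else 0 := by
    rw [← Finset.sum_filter]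
    refine Finset.sum_congr ?_ fun _ _ => rfl
    ext y
    simp [and_comm]
  have e2 : ∑ y ∈ layer Aᶜ v.2, r u y =
      ∑ y ∈ layer Finset.univ v.2, if y ∉ A.map (translate h).toEmbedding then r v y else 0 := by
    rw [← Finset.sum_filter]
    refine Finset.sum_equiv (translate h) ?_ ?_
    · intro y
      simp [Finset.mem_map_equiv, and_comm]
    · intro y _
      rw [← hr h u y, hu, Equiv.apply_symm_apply]
  rw [e1, e2, ← Finset.sum_add_distrib]
  refine Finset.sum_le_sum fun y _ => ?_
  by_cases h1 : y ∈ A <;> by_cases h2 : y ∈ A.map (translate h).toEmbedding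
  · have : y ∈ A ∩ A.map (translate h).toEmbedding := Finset.mem_inter.2 ⟨h1, h2⟩
    rw [hv, Finset.mem_singleton] at this
    simp [this, hloop]
  all_goals
    simp only [h1, h2, not_true_eq_false, not_false_eq_true, if_true, if_false]
    omega

omit hr [Fintype G] in
lemma two_mul_card_le {A : Finset (G × Bool)} {h : G} {v : G × Bool}
    (hv : A ∩ A.map (translate h).toEmbedding = {v})
    (hstab : ∀ b ∈ layer A !v.2, ∀ k ∈ layer A !v.2,
      A.map (translate (b.1⁻¹ * k.1)).toEmbedding = A)
    (hh : A.map (translate h).toEmbedding ≠ A) :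
    2 * #(layer A !v.2) ≤ #(layer A v.2) := by
  rcases (layer A !v.2).eq_empty_or_nonempty with he | ⟨b, hb⟩
  · simp [he]
  have hvm : v ∈ A ∩ A.map (translate h).toEmbedding := by simp [hv]
  obtain ⟨hvA, hvB⟩ := Finset.mem_inter.1 hvm
  rw [Finset.mem_map_equiv] at hvB
  have hmove : ∀ k ∈ layer A !v.2, ∀ x ∈ A, (x.1 * (b.1⁻¹ * k.1), x.2) ∈ A := by
    intro k hk x hx
    rw [← hstab b hb k hk, Finset.mem_map_equiv]
    simpa [mul_assoc] using hx
  let f : G → G × Bool → G × Bool := fun a k => (a * (b.1⁻¹ * k.1), v.2)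
  have hinj : ∀ a, Set.InjOn (f a) (layer A !v.2 : Finset (G × Bool)) := by
    intro a k hk k' hk' he
    simp [f] at he
    simp only [Finset.mem_coe, mem_layer] at hk hk'
    exact Prod.ext he (hk.2.trans hk'.2.symm)
  have hdisj : Disjoint ((layer A !v.2).image (f v.1)) ((layer A !v.2).image (f (v.1 * h⁻¹))) := by
    rw [Finset.disjoint_left]
    intro x hx hx'
    obtain ⟨k, hk, rfl⟩ := Finset.mem_image.1 hx
    obtain ⟨k', hk', he⟩ := Finset.mem_image.1 hx'
    apply hh
    have heq : h⁻¹ * (b.1⁻¹ * k'.1) = b.1⁻¹ * k.1 := by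
      have := congrArg Prod.fst he
      simp only [f] at this
      rw [mul_assoc] at this
      exact mul_left_cancel this
    have hh' : h * (b.1⁻¹ * k.1) = b.1⁻¹ * k'.1 := by
      rw [← heq]; group
    ext x
    have h1 := hstab b hb k hk
    have h2 := hstab b hb k' hk'
    have h3 : ∀ y, y ∈ A ↔ (translate (b.1⁻¹ * k.1)) y ∈ A := by
      intro y
      conv_rhs => rw [← h1]
      simp only [Finset.mem_map_equiv, Equiv.symm_apply_apply]
    have h4 : ∀ y, y ∈ A ↔ (translate (b.1⁻¹ * k'.1)) y ∈ A := by
      intro y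
      conv_rhs => rw [← h2]
      simp only [Finset.mem_map_equiv, Equiv.symm_apply_apply]
    rw [Finset.mem_map_equiv, h3 x, h4]
    simp only [translate_apply, translate_symm_apply, ← hh']
    group
  have hsub : (layer A !v.2).image (f v.1) ∪ (layer A !v.2).image (f (v.1 * h⁻¹)) ⊆
      layer A v.2 := by
    intro x hx
    rcases Finset.mem_union.1 hx with hx | hx
    · obtain ⟨k, hk, rfl⟩ := Finset.mem_image.1 hx
      simpa [f] using hmove k hk v hvA
    · obtain ⟨k, hk, rfl⟩ := Finset.mem_image.1 hx
      simpa [f] using hmove k hk _ hvB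
  have := Finset.card_le_card hsub
  rw [Finset.card_union_of_disjoint hdisj, Finset.card_image_of_injOn (hinj _),
    Finset.card_image_of_injOn (hinj _)] at this
  omega

lemma card_layer_le_of_crossing (hloop : ∀ x, r x x = 0) (hone : ∀ x y, r x y ≤ 1) {L : ℕ}
    (hL : ∀ C : Finset (G × Bool), C.Nonempty → C ≠ Finset.univ → L ≤ cutWeight r C)
    {A : Finset (G × Bool)} (hdA : cutWeight r A = L)
    (hmin : ∀ C : Finset (G × Bool), C ≠ Finset.univ → cutWeight r C = L → 2 ≤ #C → #A ≤ #C)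
    (hinter : ∀ h, A.map (translate h).toEmbedding ≠ A →
      ¬ Disjoint A (A.map (translate h).toEmbedding) →
      ∃ w, A ∩ A.map (translate h).toEmbedding = {w} ∧ cutWeight r {w} = L)
    {c : Bool} (hpos : 0 < layerDegree r c !c) (hne : (layer A !c).Nonempty) {h : G}
    (hB : A.map (translate h).toEmbedding ≠ A)
    (hd : ¬ Disjoint A (A.map (translate h).toEmbedding))
    (ht : layerDegree r c (!c) < layerDegree r (!c) c) :
    #(layer A c) ≤ #(layer A !c) := by
  by_contra! hlt
  obtain ⟨z, hz⟩ := hne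
  have hz2 := (mem_layer.1 hz).2
  have hzL : L ≤ layerDegree r c (!c) + layerDegree r (!c) !c := by
    have := hL {z}ᶜ ⟨(z.1, c), by simp [Prod.ext_iff, hz2]⟩ (by simp)
    rwa [cutWeight_compl_singleton hr hloop z c, hz2] at this
  have hside : ∀ w, cutWeight r {w} = L → w.2 = c := by
    intro w hw
    by_contra hwc
    rw [cutWeight_singleton hr hloop w c, Bool.eq_not_of_ne hwc] at hw
    omega
  obtain ⟨v, hv, hvL⟩ := hinter h hB hd
  have hvc := hside v hvL
  rw [cutWeight_singleton hr hloop v c, hvc] at hvL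
  have hstab : ∀ b ∈ layer A !c, ∀ k ∈ layer A !c,
      A.map (translate (b.1⁻¹ * k.1)).toEmbedding = A := by
    intro b hb k hk
    by_contra hne
    rw [mem_layer] at hb hk
    have hkm : k ∈ A ∩ A.map (translate (b.1⁻¹ * k.1)).toEmbedding := by
      rw [Finset.mem_inter, Finset.mem_map_equiv]
      refine ⟨hk.1, ?_⟩
      convert hb.1 using 1
      exact Prod.ext (by simp) (by simp [hk.2, hb.2])
    obtain ⟨w, hw, hwL⟩ := hinter _ hne
      (Finset.not_disjoint_iff.2 ⟨k, Finset.mem_inter.1 hkm⟩)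
    rw [hw, Finset.mem_singleton] at hkm
    have := hside w hwL
    rw [← hkm, hk.2] at this
    simp at this
  have hcard := two_mul_card_le hv (by rwa [hvc]) hB
  have hh1 : h ≠ 1 := by
    rintro rfl
    apply hB
    ext x
    simp [Finset.mem_map_equiv]
  have hD00 := layerDegree_le_of_inter_translate hr hloop hv hh1
  rw [hvc] at hcard hD00
  have hcut : cutWeight r A =
      arcWeight r (layer A c) (layer Aᶜ c) + arcWeight r (layer A c) (layer Aᶜ !c) +
      (arcWeight r (layer A !c) (layer Aᶜ c) + arcWeight r (layer A !c) (layer Aᶜ !c)) := by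
    rw [arcWeight_layer_right, arcWeight_layer_right, arcWeight_layer_left]
    rfl
  have hD01 := arcWeight_layer_add hr A c !c
  have hE01 := arcWeight_layer_le hr A c !c
  have hD10 := arcWeight_layer_add hr A (!c) c
  have hD11 := arcWeight_layer_add hr A (!c) !c
  have hz1 : 1 ≤ #(layer A !c) := Finset.card_pos.2 ⟨z, hz⟩
  obtain ⟨m, hm⟩ := Nat.exists_eq_add_of_lt hlt
  rw [hm, add_mul, add_mul] at hD01
  have hm0 : m = 0 := by
    have : m * layerDegree r c (!c) ≤ 0 := by omega
    rcases Nat.mul_eq_zero.1 (Nat.le_zero.1 this) with h | h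
    · exact h
    · omega
  subst hm0
  have ha1 : #(layer A !c) = 1 := by omega
  have ha0 : #(layer A c) = 2 := by omega
  have hAz : layer A (!c) = {z} := by
    obtain ⟨z', hz'⟩ := Finset.card_eq_one.1 ha1
    rw [hz', Finset.mem_singleton] at hz
    rw [hz', hz]
  obtain ⟨x, y, hxy, hAxy⟩ := Finset.card_eq_two.1 ha0
  rw [ha1] at hD01 hD10 hD11 hE01
  rw [hAz] at hD01 hD10 hD11 hE01 hcut
  have e11 : arcWeight r {z} {z} = 0 := by simp [arcWeight, hloop]
  have e10 : arcWeight r {z} (layer A c) = r z x + r z y := by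
    rw [hAxy]; simp [arcWeight, Finset.sum_pair hxy]
  have e01 : arcWeight r (layer A c) {z} = r x z + r y z := by
    rw [hAxy]; simp [arcWeight, Finset.sum_pair hxy]
  rw [e11] at hD11
  rw [e10] at hD10
  rw [e01] at hD01 hE01
  have := hone z x
  have := hone z y
  have := hone x z
  have := hone y z
  have hAcard := card_layer_add A c
  have hpair : ∀ w ∈ layer A c, r w z = 1 → r z w = 1 → False := by
    intro w hw h1 h2
    have hw2 := (mem_layer.1 hw).2
    have hwz : w ≠ z := by
      rintro rfl
      rw [hw2] at hz2
      simp at hz2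
    have hc := Finset.card_pair hwz
    have hadd := cutWeight_add hr {w, z} c
    have l1 : layer {w, z} c = {w} := by
      ext u; simp only [mem_layer, Finset.mem_insert, Finset.mem_singleton]
      constructor
      · rintro ⟨rfl | rfl, h⟩
        · rfl
        · simp [hz2] at h
      · rintro rfl; exact ⟨Or.inl rfl, hw2⟩
    have l2 : layer {w, z} (!c) = {z} := by
      ext u; simp only [mem_layer, Finset.mem_insert, Finset.mem_singleton]
      constructor
      · rintro ⟨rfl | rfl, h⟩
        · simp [hw2] at h
        · rfl
      · rintro rfl; exact ⟨Or.inr rfl, hz2⟩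
    have hin : arcWeight r {w, z} {w, z} = 2 := by
      simp [arcWeight, Finset.sum_pair hwz, hloop, h1, h2]
    rw [l1, l2, hin] at hadd
    simp only [Finset.card_singleton, one_mul] at hadd
    have hnu : ({w, z} : Finset (G × Bool)) ≠ Finset.univ := by
      intro he
      have := Finset.card_le_univ A
      rw [← Finset.card_univ, ← he] at this
      omega
    have hle := hL {w, z} ⟨w, by simp⟩ hnu
    have := hmin {w, z} hnu (by omega) (by omega)
    omega
  have hx : x ∈ layer A c := by simp [hAxy]
  have hy : y ∈ layer A c := by simp [hAxy]
  rcases Nat.eq_zero_or_pos (r x z) with h0 | h0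
  · exact hpair y hy (by omega) (by omega)
  · exact hpair x hx (by omega) (by omega)

lemma exists_inter_eq_singleton {L : ℕ}
    (hL : ∀ C : Finset (G × Bool), C.Nonempty → C ≠ Finset.univ → L ≤ cutWeight r C)
    {A : Finset (G × Bool)} (hdA : cutWeight r A = L)
    (hmin : ∀ C : Finset (G × Bool), C ≠ Finset.univ → cutWeight r C = L → 2 ≤ #C → #A ≤ #C)
    (hhalf : 2 * #A ≤ Fintype.card (G × Bool)) {h : G}
    (hB : A.map (translate h).toEmbedding ≠ A)
    (hd : ¬ Disjoint A (A.map (translate h).toEmbedding)) :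
    ∃ w, A ∩ A.map (translate h).toEmbedding = {w} ∧ cutWeight r {w} = L := by
  set B := A.map (translate h).toEmbedding with hBdef
  have hBcard : #B = #A := Finset.card_map _
  have hI : (A ∩ B).Nonempty := by
    rwa [Finset.nonempty_iff_ne_empty, ne_eq, ← Finset.disjoint_iff_inter_eq_empty]
  have hIpos := Finset.card_pos.2 hI
  have hUI := Finset.card_union_add_card_inter A B
  have hIA : #(A ∩ B) ≤ #A := Finset.card_le_card Finset.inter_subset_left
  have hU : A ∪ B ≠ Finset.univ := by
    intro he
    rw [he, Finset.card_univ] at hUI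
    omega
  have hIu : A ∩ B ≠ Finset.univ := by
    intro he
    rw [he, Finset.card_univ] at hIA hIpos
    omega
  have hsub := cutWeight_submodular r A B
  have h1 := hL _ hI hIu
  have h2 := hL _ (hI.mono (Finset.inter_subset_left.trans Finset.subset_union_left)) hU
  have h3 : cutWeight r B = L := by rw [hBdef, cutWeight_map_translate hr, hdA]
  have hIL : cutWeight r (A ∩ B) = L := by omega
  have hI1 : #(A ∩ B) = 1 := by
    by_contra hne
    have hle := hmin _ hIu hIL (by omega)
    have e1 : A ∩ B = A := Finset.eq_of_subset_of_card_le Finset.inter_subset_left hle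
    have e2 : A ⊆ B := by rw [← e1]; exact Finset.inter_subset_right
    exact hB (Finset.eq_of_subset_of_card_le e2 hBcard.le).symm
  obtain ⟨w, hw⟩ := Finset.card_eq_one.1 hI1
  exact ⟨w, hw, by rw [← hw, hIL]⟩

lemma map_translate_eq_or_disjoint (hloop : ∀ x, r x x = 0) (hone : ∀ x y, r x y ≤ 1) {L : ℕ}
    (hpos : ∀ i, 0 < layerDegree r i !i)
    (hL : ∀ C : Finset (G × Bool), C.Nonempty → C ≠ Finset.univ → L ≤ cutWeight r C)
    {A : Finset (G × Bool)} (hdA : cutWeight r A = L)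
    (hmin : ∀ C : Finset (G × Bool), C ≠ Finset.univ → cutWeight r C = L → 2 ≤ #C → #A ≤ #C)
    (hhalf : 2 * #A ≤ Fintype.card (G × Bool)) (hne : ∀ i, (layer A i).Nonempty) (h : G) :
    A.map (translate h).toEmbedding = A ∨ Disjoint A (A.map (translate h).toEmbedding) := by
  by_contra! hcon
  obtain ⟨hB, hd⟩ := hcon
  have hinter : ∀ h, A.map (translate h).toEmbedding ≠ A →
      ¬ Disjoint A (A.map (translate h).toEmbedding) →
      ∃ w, A ∩ A.map (translate h).toEmbedding = {w} ∧ cutWeight r {w} = L :=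
    fun h hB hd => exists_inter_eq_singleton hr hL hdA hmin hhalf hB hd
  have hunb := fun c => card_layer_le_of_crossing hr hloop hone hL hdA hmin hinter (hpos c)
    (hne !c) hB hd
  rcases le_or_gt (cutWeight r Aᶜ) L with hle | hgt
  · obtain ⟨v, hv, -⟩ := hinter h hB hd
    have hvm : v ∈ A ∩ A.map (translate h).toEmbedding := by simp [hv]
    obtain ⟨hvA, hvB⟩ := Finset.mem_inter.1 hvm
    rw [Finset.mem_map_equiv] at hvB
    set B := A.map (translate h).toEmbedding with hBdef
    have hBcard : #B = #A := Finset.card_map _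
    have hA3 : 3 ≤ #A := by
      have h1 := card_layer_add A v.2
      have h2 := Finset.card_pos.2 (hne !v.2)
      have h3 : ¬ #(layer A v.2) ≤ 1 := by
        intro hle
        have := Finset.card_le_one.1 hle v (by simp [hvA]) _ (mem_layer.2 ⟨hvB, rfl⟩)
        have h4 := congrArg Prod.fst this
        simp only [translate_symm_apply, left_eq_mul, inv_eq_one] at h4
        apply hB
        subst h4
        ext x
        simp [hBdef, Finset.mem_map_equiv]
      omega
    have hBc : cutWeight r Bᶜ = cutWeight r Aᶜ := by
      rw [← cutWeight_swap, ← cutWeight_swap, hBdef]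
      exact cutWeight_map_translate (fun h x y => hr h y x) h A
    have hdiff := Finset.card_sdiff_add_card_inter A B
    rw [hv, Finset.card_singleton, Finset.sdiff_eq_inter_compl] at hdiff
    have hu1 : A ∩ Bᶜ ≠ Finset.univ := by
      intro he
      have := Finset.card_le_univ A
      rw [he, Finset.card_univ] at hdiff
      omega
    have hu2 : A ∪ Bᶜ ≠ Finset.univ := by
      intro he
      apply hB
      refine Finset.eq_of_subset_of_card_le (fun x hx => ?_) hBcard.ge
      have : x ∈ A ∪ Bᶜ := by simp [he]
      rcases Finset.mem_union.1 this with h | h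
      · exact h
      · exact absurd hx (Finset.mem_compl.1 h)
    have hsub := cutWeight_submodular r A Bᶜ
    have h1 := hL _ (Finset.card_pos.1 (by omega)) hu1
    have h2 := hL _ ⟨v, Finset.mem_union_left _ hvA⟩ hu2
    have := hmin _ hu1 (by omega) (by omega)
    omega
  · have h1 := cutWeight_add hr A false
    have h2 := cutWeight_compl_add hr A false
    have h3 := hunb false
    have h4 := hunb true
    simp only [Bool.not_false, Bool.not_true] at h1 h2 h3 h4
    rcases lt_trichotomy (layerDegree r false true) (layerDegree r true false) with ht | ht | ht
    · have := h3 ht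
      nlinarith
    · rw [ht] at h1 h2
      nlinarith
    · have := h4 ht
      nlinarith

omit hr [Fintype G] [DecidableEq G] in
lemma card_layer_le_of_translate {A : Finset (G × Bool)}
    (htr : ∀ h, A.map (translate h).toEmbedding = A ∨
      Disjoint A (A.map (translate h).toEmbedding))
    (i j : Bool) (hj : (layer A j).Nonempty) : #(layer A i) ≤ #(layer A j) := by
  rcases (layer A i).eq_empty_or_nonempty with he | ⟨a, ha⟩
  · simp [he]
  obtain ⟨b, hb⟩ := hj
  rw [mem_layer] at ha hb
  refine Finset.card_le_card_of_injOn (fun x => (b.1 * (a.1⁻¹ * x.1), j)) ?_ ?_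
  · intro x hx
    have hx := mem_layer.1 hx
    refine mem_layer.2 ⟨?_, rfl⟩
    have hmem : x ∈ A.map (translate (a.1⁻¹ * x.1)).toEmbedding := by
      rw [Finset.mem_map_equiv]
      convert ha.1 using 1
      exact Prod.ext (by simp) (by simp [hx.2, ha.2])
    rcases htr (a.1⁻¹ * x.1) with h | h
    · rw [← h, Finset.mem_map_equiv]
      convert hb.1 using 1
      exact Prod.ext (by simp [mul_assoc]) (by simp [hb.2])
    · exact absurd hmem (Finset.disjoint_left.1 h hx.1)
  · intro x hx y hy hxy
    simp only [Finset.mem_coe, mem_layer] at hx hy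
    simp at hxy
    exact Prod.ext hxy (hx.2.trans hy.2.symm)

end Invariant

section Relation

open Classical in
/-- The `0`-`1` weight of a relation. -/
noncomputable def relWeight {V : Type*} (R : V → V → Prop) (x y : V) : ℕ := if R x y then 1 else 0

variable {V : Type*} {R : V → V → Prop}

lemma omegaMinus_eq_omegaPlus_compl (A : Set V) : omegaMinus R A = omegaPlus R Aᶜ := by
  ext p
  simp [omegaMinus, omegaPlus]

lemma isDisconnectingArcSet_omegaPlus {C : Set V} (hC : C.Nonempty) (hC' : C ≠ Set.univ) :
    IsDisconnectingArcSet R (omegaPlus R C) := by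
  refine ⟨fun p hp => hp.1, fun hsc => ?_⟩
  obtain ⟨u, hu⟩ := hC
  obtain ⟨v, hv⟩ := (Set.ne_univ_iff_exists_notMem C).1 hC'
  have : ∀ w, Relation.ReflTransGen (fun u v => R u v ∧ (u, v) ∉ omegaPlus R C) u w → w ∈ C := by
    intro w hw
    induction hw with
    | refl => exact hu
    | tail _ h ih =>
      by_contra hc
      exact h.2 ⟨h.1, ih, hc⟩
  exact hv (this v (hsc u v))

lemma arcConnectivity_le {C : Set V} (hC : C.Nonempty) (hC' : C ≠ Set.univ) :
    arcConnectivity R ≤ (omegaPlus R C).ncard :=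
  Nat.sInf_le ⟨_, isDisconnectingArcSet_omegaPlus hC hC', rfl⟩

lemma exists_omegaPlus_subset_of_isDisconnectingArcSet {W : Set (V × V)}
    (hW : IsDisconnectingArcSet R W) :
    ∃ C : Set V, C.Nonempty ∧ C ≠ Set.univ ∧ omegaPlus R C ⊆ W := by
  have h := hW.2
  unfold DigraphStronglyConnected at h
  push Not at h
  obtain ⟨u, v, huv⟩ := h
  refine ⟨{w | Relation.ReflTransGen (fun u v => R u v ∧ (u, v) ∉ W) u w},
    ⟨u, Relation.ReflTransGen.refl⟩, fun he => huv (he.symm ▸ Set.mem_univ v :), ?_⟩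
  rintro ⟨a, b⟩ ⟨hab, ha, hb⟩
  by_contra hc
  exact hb (Relation.ReflTransGen.tail ha ⟨hab, hc⟩)

lemma exists_posFragment_of_not_superLambda [Finite V] (hloop : ∀ x, ¬ R x x)
    (hns : ¬ SuperLambda R) :
    ∃ C, IsPosFragment R C ∧ 2 ≤ C.ncard ∧ 2 ≤ Cᶜ.ncard := by
  unfold SuperLambda at hns
  push Not at hns
  obtain ⟨W, hW, hWc, hout, hin⟩ := hns
  obtain ⟨C, hC, hC', hCW⟩ := exists_omegaPlus_subset_of_isDisconnectingArcSet hW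
  have heq : omegaPlus R C = W :=
    Set.eq_of_subset_of_ncard_le hCW (by rw [hWc]; exact arcConnectivity_le hC hC') (Set.toFinite _)
  refine ⟨C, ⟨hC, hC', by rw [heq, hWc]⟩, ?_, ?_⟩
  · by_contra hlt
    have h1 := (Set.ncard_pos (Set.toFinite C)).2 hC
    obtain ⟨v, rfl⟩ := Set.ncard_eq_one.1 (show C.ncard = 1 by omega)
    apply hout v
    rw [← heq]
    ext ⟨a, b⟩
    simp only [omegaPlus, outArcsOf, Set.mem_ofPred_eq, Set.mem_singleton_iff]
    exact ⟨fun h => ⟨h.1, h.2.1⟩, fun h => ⟨h.1, h.2, fun hb => hloop a (by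
      have := h.1; rwa [hb, ← h.2] at this)⟩⟩
  · by_contra hlt
    have h1 := (Set.ncard_pos (Set.toFinite Cᶜ)).2 (Set.nonempty_compl.2 hC')
    obtain ⟨v, hv⟩ := Set.ncard_eq_one.1 (show Cᶜ.ncard = 1 by omega)
    apply hin v
    rw [← heq]
    have hmem : ∀ x, x ∈ C ↔ x ≠ v := by
      intro x
      have : x ∈ Cᶜ ↔ x ∈ ({v} : Set V) := by rw [hv]
      rw [Set.mem_compl_iff, Set.mem_singleton_iff] at this
      tauto
    ext ⟨a, b⟩
    simp only [omegaPlus, inArcsOf, Set.mem_ofPred_eq, hmem, not_not]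
    exact ⟨fun h => ⟨h.1, h.2.2⟩, fun h => ⟨h.1, fun ha => hloop a (by
      have := h.1; rwa [h.2, ← ha] at this), h.2⟩⟩

lemma isArcFragment_compl {A : Set V} (hA : IsArcFragment R A) : IsArcFragment R Aᶜ := by
  rcases hA with ⟨h1, h2, h3⟩ | ⟨h1, h2, h3⟩
  · refine Or.inr ⟨Set.nonempty_compl.2 h2, by simpa using h1.ne_empty, ?_⟩
    rwa [omegaMinus_eq_omegaPlus_compl, compl_compl]
  · refine Or.inl ⟨Set.nonempty_compl.2 h2, by simpa using h1.ne_empty, ?_⟩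
    rwa [← omegaMinus_eq_omegaPlus_compl]

lemma two_mul_ncard_superatom_le [Finite V] (hloop : ∀ x, ¬ R x x)
    (hns : ¬ SuperLambda R) {A : Set V} (hA : IsLambdaSuperatom R A) :
    2 * A.ncard ≤ Nat.card V := by
  obtain ⟨C, hC, hC2, hCc⟩ := exists_posFragment_of_not_superLambda hloop hns
  have h1 := hA.2.2 C (Or.inl hC) hC2
  have h2 := Set.ncard_add_ncard_compl A
  have h3 := Set.ncard_add_ncard_compl C
  have h4 := hA.2.2 Aᶜ (isArcFragment_compl hA.1) (by omega)
  omega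

variable [Fintype V] [DecidableEq V]

lemma ncard_omegaPlus (A : Finset V) :
    (omegaPlus R (A : Set V)).ncard = cutWeight (relWeight R) A := by
  classical
  have : omegaPlus R (A : Set V) =
      ((A ×ˢ Aᶜ).filter fun p : V × V => R p.1 p.2 : Finset (V × V)) := by
    ext p
    simp [omegaPlus, and_comm]
  rw [this, Set.ncard_coe_finset, Finset.card_filter, Finset.sum_product]
  rfl

lemma ncard_omegaMinus (A : Finset V) :
    (omegaMinus R (A : Set V)).ncard = cutWeight (relWeight R) Aᶜ := by
  rw [omegaMinus_eq_omegaPlus_compl, ← Finset.coe_compl, ncard_omegaPlus]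

lemma arcConnectivity_le_cutWeight {C : Finset V} (hC : C.Nonempty) (hC' : C ≠ Finset.univ) :
    arcConnectivity R ≤ cutWeight (relWeight R) C := by
  rw [← ncard_omegaPlus]
  exact arcConnectivity_le hC (by simpa using hC')

lemma isPosFragment_coe {C : Finset V} :
    IsPosFragment R (C : Set V) ↔
      C.Nonempty ∧ C ≠ Finset.univ ∧ cutWeight (relWeight R) C = arcConnectivity R := by
  simp [IsPosFragment, ncard_omegaPlus]

lemma isNegFragment_coe {C : Finset V} :
    IsNegFragment R (C : Set V) ↔
      C.Nonempty ∧ C ≠ Finset.univ ∧ cutWeight (relWeight R) Cᶜ = arcConnectivity R := by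
  simp [IsNegFragment, ncard_omegaMinus]

end Relation

section InvariantRelation

variable {G : Type*} [Group G] [Fintype G] [DecidableEq G] {R : G × Bool → G × Bool → Prop}

omit [Fintype G] [DecidableEq G] in
lemma relWeight_translate (hR : ∀ (h : G) x y, R (translate h x) (translate h y) ↔ R x y)
    (h : G) (x y : G × Bool) :
    relWeight R (translate h x) (translate h y) = relWeight R x y := by
  have := hR h x y
  unfold relWeight
  split_ifs <;> tauto

omit [DecidableEq G] in
lemma layerDegree_pos {r : G × Bool → G × Bool → ℕ}
    (hr : ∀ (h : G) (x y : G × Bool), r (translate h x) (translate h y) = r x y)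
    {x y : G × Bool} (hxy : 0 < r x y) : 0 < layerDegree r x.2 y.2 := by
  rw [← sum_out hr x y.2]
  exact hxy.trans_le (Finset.single_le_sum (f := fun y => r x y) (fun _ _ => Nat.zero_le _)
    (by simp : y ∈ layer Finset.univ y.2))

lemma superatom_translate_eq_or_disjoint
    (hR : ∀ (h : G) x y, R (translate h x) (translate h y) ↔ R x y)
    (hloop : ∀ x, ¬ R x x) (hns : ¬ SuperLambda R)
    (harc : ∀ i, ∃ x y, x.2 = i ∧ y.2 = (!i) ∧ R x y)
    {A : Finset (G × Bool)} (hA : IsLambdaSuperatom R (A : Set (G × Bool)))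
    (hne : ∀ i, (layer A i).Nonempty) (h : G) :
    A.map (translate h).toEmbedding = A ∨ Disjoint A (A.map (translate h).toEmbedding) := by
  have hr := relWeight_translate hR
  have hhalf : 2 * #A ≤ Fintype.card (G × Bool) := by
    have := two_mul_ncard_superatom_le hloop hns hA
    rwa [Set.ncard_coe_finset, Nat.card_eq_fintype_card] at this
  have hmin : ∀ C : Finset (G × Bool), IsArcFragment R (C : Set (G × Bool)) → 2 ≤ #C →
      #A ≤ #C := by
    intro C hC hC2
    have := hA.2.2 C hC (by rwa [Set.ncard_coe_finset])
    rwa [Set.ncard_coe_finset, Set.ncard_coe_finset] at this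
  have hl0 : ∀ x, relWeight R x x = 0 := fun x => by simp [relWeight, hloop]
  have hl1 : ∀ x y, relWeight R x y ≤ 1 := fun x y => by unfold relWeight; split_ifs <;> simp
  have hpos : ∀ i, 0 < layerDegree (relWeight R) i !i := by
    intro i
    obtain ⟨x, y, hx, hy, hxy⟩ := harc i
    have := layerDegree_pos hr (x := x) (y := y) (by simp [relWeight, hxy])
    rwa [hx, hy] at this
  rcases hA.1 with hp | hn
  · rw [isPosFragment_coe] at hp
    refine map_translate_eq_or_disjoint hr hl0 hl1 hpos
      (fun C hC hC' => arcConnectivity_le_cutWeight hC hC') hp.2.2 ?_ hhalf hne h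
    intro C hC hCL hC2
    exact hmin C (Or.inl (isPosFragment_coe.2 ⟨Finset.card_pos.1 (by omega), hC, hCL⟩)) hC2
  · rw [isNegFragment_coe] at hn
    refine map_translate_eq_or_disjoint (r := fun x y => relWeight R y x)
      (fun h x y => hr h y x) hl0 (fun x y => hl1 y x) ?_
      ?_ ((cutWeight_swap _ _).trans hn.2.2) ?_ hhalf hne h
    · intro i
      obtain ⟨x, y, hx, hy, hxy⟩ := harc !i
      have hy : y.2 = i := by simpa using hy
      rw [← hx, ← hy]
      exact layerDegree_pos (r := fun x y => relWeight R y x) (fun h x y => hr h y x)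
        (by simp [relWeight, hxy])
    · intro C hC hC'
      rw [cutWeight_swap]
      exact arcConnectivity_le_cutWeight (by
        rwa [Finset.nonempty_iff_ne_empty, ne_eq, Finset.compl_eq_empty_iff])
        (by rw [ne_eq, Finset.compl_eq_univ_iff]; exact hC.ne_empty)
    · intro C hC hCL hC2
      rw [cutWeight_swap] at hCL
      exact hmin C (Or.inr (isNegFragment_coe.2 ⟨Finset.card_pos.1 (by omega), hC, hCL⟩)) hC2

omit [Fintype G] [DecidableEq G] in
lemma exists_partition_translates {A : Finset (G × Bool)} (hne : ∀ i, (layer A i).Nonempty)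
    (htr : ∀ h, A.map (translate h).toEmbedding = A ∨
      Disjoint A (A.map (translate h).toEmbedding))
    (p : Set (G × Bool) → Prop) (hp : ∀ h, p (A.map (translate h).toEmbedding : Finset _)) :
    ∃ P : Set (Set (G × Bool)), (∀ B ∈ P, p B) ∧ ⋃₀ P = Set.univ ∧ P.Pairwise Disjoint := by
  refine ⟨Set.range fun h => ((A.map (translate h).toEmbedding : Finset (G × Bool)) : Set _),
    ?_, ?_, ?_⟩
  · rintro _ ⟨h, rfl⟩
    exact hp h
  · rw [Set.sUnion_eq_univ_iff]
    intro x
    obtain ⟨a, ha⟩ := hne x.2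
    rw [mem_layer] at ha
    refine ⟨_, ⟨a.1⁻¹ * x.1, rfl⟩, ?_⟩
    rw [Finset.mem_coe, Finset.mem_map_equiv]
    convert ha.1 using 1
    exact Prod.ext (by simp) (by simp [ha.2])
  · rintro _ ⟨h, rfl⟩ _ ⟨k, rfl⟩ hhk
    simp only
    rw [Finset.disjoint_coe, Finset.disjoint_left]
    intro x hx hx'
    apply hhk
    rw [Finset.mem_map_equiv] at hx hx'
    rcases htr (k * h⁻¹) with he | he
    · simp only
      conv_lhs => rw [← he]
      rw [Finset.map_map]
      congr 2
      ext y <;> simp [mul_assoc]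
    · refine absurd ?_ (Finset.disjoint_left.1 he hx)
      rw [Finset.mem_map_equiv]
      simpa using hx'

/-- In a loopless translation-invariant digraph on `G × Bool` with arcs between the two layers in
both directions, a superatom meeting both layers is balanced, and its translates form a partition
both into positive and into negative superatoms. -/
theorem superatom_partition_and_balanced
    (hR : ∀ (h : G) x y, R (translate h x) (translate h y) ↔ R x y)
    (hloop : ∀ x, ¬ R x x) (hns : ¬ SuperLambda R)
    (harc : ∀ i, ∃ x y, x.2 = i ∧ y.2 = (!i) ∧ R x y)
    {A : Finset (G × Bool)} (hA : IsLambdaSuperatom R (A : Set (G × Bool)))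
    (hne : ∀ i, (layer A i).Nonempty) :
    (∃ P : Set (Set (G × Bool)), (∀ B ∈ P, IsPosLambdaSuperatom R B) ∧
      ⋃₀ P = Set.univ ∧ P.Pairwise Disjoint) ∧
    (∃ P : Set (Set (G × Bool)), (∀ B ∈ P, IsNegLambdaSuperatom R B) ∧
      ⋃₀ P = Set.univ ∧ P.Pairwise Disjoint) ∧
    #(layer A false) = #(layer A true) := by
  have hr := relWeight_translate hR
  have htr := superatom_translate_eq_or_disjoint hR hloop hns harc hA hne
  have hbal : #(layer A false) = #(layer A true) :=
    le_antisymm (card_layer_le_of_translate htr _ _ (hne _))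
      (card_layer_le_of_translate htr _ _ (hne _))
  have hcut : cutWeight (relWeight R) A = cutWeight (relWeight R) Aᶜ := by
    have h1 := cutWeight_add hr A false
    have h2 := cutWeight_compl_add hr A false
    simp only [Bool.not_false, hbal] at h1 h2
    linarith
  have hAL : A.Nonempty ∧ A ≠ Finset.univ ∧ cutWeight (relWeight R) A = arcConnectivity R := by
    rcases hA.1 with hp | hn
    · exact isPosFragment_coe.1 hp
    · rw [hcut]
      exact isNegFragment_coe.1 hn
  have hmap : ∀ h, (A.map (translate h).toEmbedding).Nonempty ∧
      A.map (translate h).toEmbedding ≠ Finset.univ := by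
    intro h
    refine ⟨Finset.Nonempty.map hAL.1, fun he => hAL.2.1 ?_⟩
    rw [← Finset.card_eq_iff_eq_univ] at he ⊢
    rwa [Finset.card_map] at he
  have hcard : ∀ h : G,
      ((A.map (translate h).toEmbedding : Finset (G × Bool)) : Set (G × Bool)).ncard =
      (A : Set (G × Bool)).ncard := by
    intro h
    rw [Set.ncard_coe_finset, Set.ncard_coe_finset, Finset.card_map]
  refine ⟨exists_partition_translates hne htr _ fun h => ⟨?_, ?_, ?_⟩,
    exists_partition_translates hne htr _ fun h => ⟨?_, ?_, ?_⟩, hbal⟩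
  · rw [isPosFragment_coe, cutWeight_map_translate hr]
    exact ⟨(hmap h).1, (hmap h).2, hAL.2.2⟩
  · rw [hcard]; exact hA.2.1
  · rw [hcard]; exact hA.2.2
  · rw [isNegFragment_coe, ← cutWeight_swap, cutWeight_map_translate fun h x y => hr h y x,
      cutWeight_swap, ← hcut]
    exact ⟨(hmap h).1, (hmap h).2, hAL.2.2⟩
  · rw [hcard]; exact hA.2.1
  · rw [hcard]; exact hA.2.2

end InvariantRelation

lemma mdArc_translate {G : Type*} [Group G] (S0 S1 T0 T1 : Set G) (h : G) (x y : G × Bool) :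
    MDArc S0 S1 T0 T1 (translate h x) (translate h y) ↔ MDArc S0 S1 T0 T1 x y := by
  simp [MDArc, ← mul_assoc]

lemma not_mdArc_self {G : Type*} [Group G] {S0 S1 : Set G} (T0 T1 : Set G)
    (hS0 : (1 : G) ∉ S0) (hS1 : (1 : G) ∉ S1) (x : G × Bool) : ¬ MDArc S0 S1 T0 T1 x x := by
  cases hx : x.2 <;> simp [MDArc, hx, hS0, hS1]

lemma exists_mdArc_between {G : Type*} [Group G] (S0 S1 : Set G) {T0 T1 : Set G}
    (hT0 : T0.Nonempty) (hT1 : T1.Nonempty) (i : Bool) :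
    ∃ x y : G × Bool, x.2 = i ∧ y.2 = (!i) ∧ MDArc S0 S1 T0 T1 x y := by
  obtain ⟨t, ht⟩ := hT0
  obtain ⟨s, hs⟩ := hT1
  cases i
  · exact ⟨(1, false), (t, true), rfl, rfl, by simp [MDArc, ht]⟩
  · exact ⟨(s, true), (1, false), rfl, rfl, by simp [MDArc, hs]⟩

end MixedCayley

/-- the vertex set is a disjoint union of distinct positive
(resp. negative) λ-superatoms, and a λ-superatom meeting both sides meets them
in sets of equal size. -/
theorem mixedCayley_superatoms_partition_and_balanced
    {G : Type*} [Group G] [Fintype G] (S0 S1 T0 T1 : Set G)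
    (hS0 : (1 : G) ∉ S0) (hS1 : (1 : G) ∉ S1)
    (hT0 : T0.Nonempty) (hT1 : T1.Nonempty)
    (hsc : DigraphStronglyConnected (MDArc S0 S1 T0 T1))
    (hmax : arcConnectivity (MDArc S0 S1 T0 T1) = minDegree (MDArc S0 S1 T0 T1))
    (hnsuper : ¬ SuperLambda (MDArc S0 S1 T0 T1))
    (hndir : ¬ IsDirectedCycleDigraph (MDArc S0 S1 T0 T1))
    (hnbidir : ¬ IsBidirectedCycleDigraph (MDArc S0 S1 T0 T1))
    (hnF : ¬ InClassF S0 S1 T0 T1)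
    (A : Set (G × Bool)) (hA : IsLambdaSuperatom (MDArc S0 S1 T0 T1) A)
    (hA0 : (A ∩ {p : G × Bool | p.2 = false}).Nonempty)
    (hA1 : (A ∩ {p : G × Bool | p.2 = true}).Nonempty) :
    (∃ P : Set (Set (G × Bool)),
      (∀ B ∈ P, IsPosLambdaSuperatom (MDArc S0 S1 T0 T1) B) ∧
      ⋃₀ P = Set.univ ∧ P.Pairwise Disjoint) ∧
    (∃ P : Set (Set (G × Bool)),
      (∀ B ∈ P, IsNegLambdaSuperatom (MDArc S0 S1 T0 T1) B) ∧
      ⋃₀ P = Set.univ ∧ P.Pairwise Disjoint) ∧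
    (A ∩ {p : G × Bool | p.2 = false}).ncard
      = (A ∩ {p : G × Bool | p.2 = true}).ncard := by
  classical
  obtain ⟨B, rfl⟩ : ∃ B : Finset (G × Bool), (B : Set (G × Bool)) = A :=
    ⟨(Set.toFinite A).toFinset, by simp⟩
  have hlayer : ∀ i, (B : Set (G × Bool)) ∩ {p | p.2 = i} = MixedCayley.layer B i := by
    intro i
    ext p
    simp
  simp only [hlayer, Finset.coe_nonempty, Set.ncard_coe_finset] at hA0 hA1 ⊢
  exact MixedCayley.superatom_partition_and_balanced (MixedCayley.mdArc_translate S0 S1 T0 T1)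
    (MixedCayley.not_mdArc_self T0 T1 hS0 hS1) hnsuper
    (MixedCayley.exists_mdArc_between S0 S1 hT0 hT1) hA (by simp [hA0, hA1])
end

section
/- Let X = MD(G, S0, S1, T0, T1) be a strongly connected mixed Cayley digraph that is max-λ but not super-λ, neither a directed cycle nor a cycle, and not in the class F. Then X has a λ-superatom contained in X_0 or contained in X_1 if and only if one of the following holds: (1) (|T0| = 1 or |T1| = 1), 1 ≤ |S0| ≤ |S1|, and S0 ∪ {1_G} is a subgroup of G; (2) (|T0| = 1 or |T1| = 1), 1 ≤ |S1| ≤ |S0|, and S1 ∪ {1_G} is a subgroup of G. -/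
open Set Pointwise

section Digraph

variable {V W : Type*}

theorem omegaPlus_ncard_image_equiv {R : V → V → Prop} {R' : W → W → Prop} (e : V ≃ W)
    (h : ∀ u v, R' (e u) (e v) ↔ R u v) (A : Set V) :
    (omegaPlus R' (e '' A)).ncard = (omegaPlus R A).ncard := by
  have key : omegaPlus R' (e '' A) = (e.prodCongr e) '' omegaPlus R A := by
    ext ⟨x, y⟩
    obtain ⟨u, rfl⟩ := e.surjective x
    obtain ⟨v, rfl⟩ := e.surjective y
    simp [omegaPlus, h]
  rw [key, ncard_image_of_injective _ (Equiv.injective _)]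

theorem omegaPlus_ncard_of_reverse {R R' : V → V → Prop} (h : ∀ u v, R' u v ↔ R v u)
    (A : Set V) : (omegaPlus R' A).ncard = (omegaMinus R A).ncard := by
  have key : omegaPlus R' A = Prod.swap '' omegaMinus R A := by
    ext ⟨x, y⟩
    rw [image_swap_eq_preimage_swap]
    simp only [omegaPlus, omegaMinus, mem_preimage, mem_ofPred_eq, Prod.swap, h]
    tauto
  rw [key, ncard_image_of_injective _ Prod.swap_injective]

theorem omegaPlus_flip_ncard (R : V → V → Prop) (A : Set V) :
    (omegaPlus (flip R) A).ncard = (omegaMinus R A).ncard :=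
  omegaPlus_ncard_of_reverse (fun _ _ => Iff.rfl) A

theorem inDegree_eq_outDegree_of_reverse {R R' : V → V → Prop}
    (h : ∀ u v, R' u v ↔ R v u) (v : V) : inDegree R v = outDegree R' v := by
  simp only [inDegree, outDegree, h]

/-- In a loopless digraph in which every vertex of `A` has out-degree at least `d`, a set `A` of
at least two vertices with at most `d` outgoing arcs has at least `d` elements. -/
theorem le_ncard_of_omegaPlus_ncard_le [Finite V] {R : V → V → Prop} (hR : ∀ v, ¬ R v v)
    {A : Set V} {d : ℕ} (hd : ∀ v ∈ A, d ≤ outDegree R v)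
    (hA : 2 ≤ A.ncard) (hω : (omegaPlus R A).ncard ≤ d) : d ≤ A.ncard := by
  classical
  have := Fintype.ofFinite V
  have hsum : A.ncard * d ≤ {p : V × V | R p.1 p.2 ∧ p.1 ∈ A}.ncard := by
    rw [ncard_eq_toFinset_card', ncard_eq_toFinset_card',
      Finset.card_eq_sum_card_fiberwise (f := Prod.fst) (t := A.toFinset)
        (by intro p hp; simp at hp ⊢; exact hp.2), ← smul_eq_mul]
    refine Finset.card_nsmul_le_sum _ _ _ fun v hv => (hd v (by simpa using hv)).trans ?_
    rw [outDegree, ncard_eq_toFinset_card',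
      ← Finset.card_image_of_injective _ (Prod.mk_right_injective v)]
    refine Finset.card_le_card fun p hp => ?_
    simp only [Finset.mem_image, mem_toFinset, mem_ofPred_eq] at hp
    obtain ⟨w, hw, rfl⟩ := hp
    simpa [hw] using hv
  have hoff : A.offDiag.ncard = A.ncard * A.ncard - A.ncard := by
    rw [ncard_eq_toFinset_card', ncard_eq_toFinset_card', toFinset_offDiag,
      Finset.offDiag_card]
  have hsub : {p : V × V | R p.1 p.2 ∧ p.1 ∈ A} ⊆ omegaPlus R A ∪ A.offDiag := by
    rintro ⟨u, v⟩ ⟨huv, hu⟩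
    by_cases hv : v ∈ A
    · exact Or.inr ⟨hu, hv, fun h => hR u (by simpa [← show u = v from h] using huv)⟩
    · exact Or.inl ⟨huv, hu, hv⟩
  have hle := (hsum.trans (ncard_le_ncard hsub)).trans (ncard_union_le _ _)
  rw [hoff] at hle
  obtain ⟨k, hk⟩ := Nat.exists_eq_add_of_le' hA
  rw [hk] at hle ⊢
  have h1 : (k + 2) * (k + 2) - (k + 2) = (k + 1) * (k + 2) := by
    rw [Nat.sub_eq_iff_eq_add (Nat.le_mul_self _)]; ring
  rw [h1] at hle
  exact Nat.le_of_mul_le_mul_left (by linarith : (k + 1) * d ≤ (k + 1) * (k + 2)) (by omega)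

end Digraph

section MixedCayley

variable {G : Type*} [Group G]

/-- The bijection of `G × Bool` exchanging the two sides. -/
def swapSides (G : Type*) : G × Bool ≃ G × Bool :=
  (Equiv.refl G).prodCongr Equiv.boolNot

theorem MDArc_swapSides (S0 S1 T0 T1 : Set G) (u v : G × Bool) :
    MDArc S1 S0 T1⁻¹ T0⁻¹ (swapSides G u) (swapSides G v) ↔ MDArc S0 S1 T0 T1 u v := by
  obtain ⟨g, _ | _⟩ := u <;> obtain ⟨h, _ | _⟩ := v <;>
    simp only [MDArc, swapSides, Equiv.prodCongr_apply, Prod.map, Equiv.refl_apply,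
      Equiv.boolNot_apply, Bool.not_false, Bool.not_true, Bool.false_eq_true,
      Bool.true_eq_false, false_and, true_and, false_or, or_false]
  · constructor
    · rintro ⟨t, ht, e⟩
      exact ⟨t⁻¹, ht, by simp [e]⟩
    · rintro ⟨t, ht, e⟩
      exact ⟨t⁻¹, by simpa using ht, by simp [e]⟩
  · constructor
    · rintro ⟨t, ht, e⟩
      exact ⟨t⁻¹, ht, by simp [e]⟩
    · rintro ⟨t, ht, e⟩
      exact ⟨t⁻¹, by simpa using ht, by simp [e]⟩

theorem MDArc_reverse (S0 S1 T0 T1 : Set G) (u v : G × Bool) :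
    MDArc S0⁻¹ S1⁻¹ T1 T0 u v ↔ MDArc S0 S1 T0 T1 v u := by
  obtain ⟨g, _ | _⟩ := u <;> obtain ⟨h, _ | _⟩ := v <;>
    simp [MDArc, eq_inv_mul_iff_mul_eq, @eq_comm G g]

theorem MDArc_irrefl {S0 S1 : Set G} (T0 T1 : Set G) (hS0 : (1 : G) ∉ S0) (hS1 : (1 : G) ∉ S1)
    (v : G × Bool) : ¬ MDArc S0 S1 T0 T1 v v := by
  rintro (⟨-, -, s, hs, e⟩ | ⟨-, -, s, hs, e⟩ | ⟨h, h', -⟩ | ⟨h, h', -⟩)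
  · exact hS0 (by simpa [← right_eq_mul.1 e] using hs)
  · exact hS1 (by simpa [← right_eq_mul.1 e] using hs)
  all_goals simp [h] at h'

theorem outDegree_MDArc_false [Finite G] (S0 S1 T0 T1 : Set G) (g : G) :
    outDegree (MDArc S0 S1 T0 T1) (g, false) = S0.ncard + T0.ncard := by
  have key : {w | MDArc S0 S1 T0 T1 (g, false) w} =
      (fun s => (s * g, false)) '' S0 ∪ (fun t => (t * g, true)) '' T0 := by
    ext ⟨x, _ | _⟩ <;> simp [MDArc, @eq_comm G x]
  rw [outDegree, key, ncard_union_eq, ncard_image_of_injective, ncard_image_of_injective]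
  · intro a b h; simpa using h
  · intro a b h; simpa using h
  · rw [disjoint_left]
    rintro _ ⟨s, -, rfl⟩ ⟨t, -, h⟩
    simp at h

theorem ncard_inv_eq (S : Set G) : S⁻¹.ncard = S.ncard := by
  rw [← image_inv_eq_inv, ncard_image_of_injective _ inv_injective]

theorem outDegree_MDArc_true [Finite G] (S0 S1 T0 T1 : Set G) (g : G) :
    outDegree (MDArc S0 S1 T0 T1) (g, true) = S1.ncard + T1.ncard := by
  have h := outDegree_MDArc_false S1 S0 T1⁻¹ T0⁻¹ g
  rw [ncard_inv_eq] at h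
  rw [← h, outDegree, outDegree, ← ncard_image_of_injective _ (swapSides G).injective]
  congr 1
  ext x
  obtain ⟨w, rfl⟩ := (swapSides G).surjective x
  rw [(swapSides G).injective.mem_set_image]
  exact (MDArc_swapSides S0 S1 T0 T1 (g, true) w).symm

theorem inDegree_MDArc_false [Finite G] (S0 S1 T0 T1 : Set G) (g : G) :
    inDegree (MDArc S0 S1 T0 T1) (g, false) = S0.ncard + T1.ncard := by
  rw [inDegree_eq_outDegree_of_reverse (MDArc_reverse S0 S1 T0 T1), outDegree_MDArc_false,
    ncard_inv_eq]

theorem inDegree_MDArc_true [Finite G] (S0 S1 T0 T1 : Set G) (g : G) :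
    inDegree (MDArc S0 S1 T0 T1) (g, true) = S1.ncard + T0.ncard := by
  rw [inDegree_eq_outDegree_of_reverse (MDArc_reverse S0 S1 T0 T1), outDegree_MDArc_true,
    ncard_inv_eq]

theorem minDegree_MDArc [Finite G] (S0 S1 T0 T1 : Set G) :
    minDegree (MDArc S0 S1 T0 T1) =
      min S0.ncard S1.ncard + min T0.ncard T1.ncard := by
  have key : {n | ∃ v, n = outDegree (MDArc S0 S1 T0 T1) v ∨
      n = inDegree (MDArc S0 S1 T0 T1) v} =
      {S0.ncard + T0.ncard, S0.ncard + T1.ncard, S1.ncard + T0.ncard, S1.ncard + T1.ncard} := by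
    ext n
    simp only [mem_ofPred_eq, Prod.exists, Bool.exists_bool, outDegree_MDArc_false,
      outDegree_MDArc_true, inDegree_MDArc_false, inDegree_MDArc_true, exists_const,
      mem_insert_iff, mem_singleton_iff]
    tauto
  rw [minDegree, key]
  refine IsLeast.csInf_eq ⟨?_, ?_⟩
  · simp only [mem_insert_iff, mem_singleton_iff]; omega
  · intro n hn
    simp only [mem_insert_iff, mem_singleton_iff] at hn
    omega

theorem exists_subgroup_of_mul_mem [Finite G] {S : Set G} (h1 : (1 : G) ∈ S)
    (hmul : ∀ x ∈ S, ∀ y ∈ S, x * y ∈ S) : ∃ H : Subgroup G, (H : Set G) = S := by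
  let M : Submonoid G := ⟨⟨S, fun hx hy => hmul _ hx _ hy⟩, h1⟩
  refine ⟨{ M with inv_mem' := fun {x} hx => ?_ }, rfl⟩
  have hx' : x⁻¹ ∈ Submonoid.powers x :=
    mem_powers_iff_mem_zpowers.2 (inv_mem (Subgroup.mem_zpowers x))
  exact (Submonoid.powers_le.2 (show x ∈ M from hx)) hx'

theorem exists_subgroup_coe_inv_union_one {S : Set G}
    (h : ∃ H : Subgroup G, (H : Set G) = S⁻¹ ∪ {1}) :
    ∃ H : Subgroup G, (H : Set G) = S ∪ {1} := by
  obtain ⟨H, hH⟩ := h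
  refine ⟨H, ?_⟩
  rw [← inv_coe_set (H := H), hH]
  simp

/-- The arcs from `A ⊆ X_0` to `X_1` all leave `A`, and there are `|A| |T0|` of them. -/
theorem crossArcs_subset_omegaPlus_and_ncard [Finite G] (S0 S1 T0 T1 : Set G) {A : Set (G × Bool)}
    (hA : A ⊆ {p | p.2 = false}) :
    (fun q : (G × Bool) × G => (q.1, (q.2 * q.1.1, true))) '' (A ×ˢ T0) ⊆
        omegaPlus (MDArc S0 S1 T0 T1) A ∧
      ((fun q : (G × Bool) × G => (q.1, (q.2 * q.1.1, true))) '' (A ×ˢ T0)).ncard =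
        A.ncard * T0.ncard := by
  constructor
  · rintro _ ⟨⟨⟨g, i⟩, t⟩, ⟨hu, ht⟩, rfl⟩
    have hi : i = false := hA hu
    subst hi
    exact ⟨by simpa [MDArc] using ht, hu, fun h => by simpa using hA h⟩
  · rw [ncard_image_of_injective, ncard_prod]
    rintro ⟨u, s⟩ ⟨v, t⟩ h
    simp only [Prod.mk.injEq, and_true] at h
    obtain ⟨rfl, h⟩ := h
    simpa using h

theorem subgroup_of_omegaPlus_le [Finite G] {S0 S1 T0 T1 : Set G} (hS0 : (1 : G) ∉ S0)
    (hS1 : (1 : G) ∉ S1) (hT0 : T0.Nonempty) {A : Set (G × Bool)}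
    (hA : A ⊆ {p | p.2 = false}) (hA2 : 2 ≤ A.ncard)
    (h0 : (omegaPlus (MDArc S0 S1 T0 T1) A).ncard ≤ S0.ncard + T0.ncard)
    (h1 : (omegaPlus (MDArc S0 S1 T0 T1) A).ncard ≤ S1.ncard + T0.ncard) :
    T0.ncard = 1 ∧ 1 ≤ S0.ncard ∧ S0.ncard ≤ S1.ncard ∧
      ∃ H : Subgroup G, (H : Set G) = S0 ∪ {1} := by
  have hTpos : 1 ≤ T0.ncard := hT0.ncard_pos
  have hdA : S0.ncard + T0.ncard ≤ A.ncard := by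
    refine le_ncard_of_omegaPlus_ncard_le (MDArc_irrefl T0 T1 hS0 hS1) ?_ hA2 h0
    rintro ⟨g, i⟩ hu
    have hi : i = false := hA hu
    rw [hi, outDegree_MDArc_false]
  obtain ⟨hsub, hcard⟩ := crossArcs_subset_omegaPlus_and_ncard S0 S1 T0 T1 hA
  have hle := ncard_le_ncard hsub
  rw [hcard] at hle
  have hT : T0.ncard = 1 := by
    by_contra hne
    have := Nat.mul_le_mul_left A.ncard (show 2 ≤ T0.ncard by omega)
    omega
  rw [hT] at h0 h1 hdA hle hcard
  refine ⟨hT, by omega, by omega, ?_⟩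
  have hω := eq_of_subset_of_ncard_le hsub (by omega)
  have hclosed : ∀ s ∈ S0, ∀ g, (g, false) ∈ A → (s * g, false) ∈ A := by
    intro s hs g hg
    by_contra hsg
    have hmem : ((g, false), (s * g, false)) ∈ omegaPlus (MDArc S0 S1 T0 T1) A :=
      ⟨by simpa [MDArc] using hs, hg, hsg⟩
    rw [← hω] at hmem
    obtain ⟨q, -, hq⟩ := hmem
    simp at hq
  obtain ⟨⟨b, i⟩, hb⟩ : A.Nonempty := nonempty_of_ncard_ne_zero (by omega)
  obtain rfl : i = false := hA hb
  have hinj : Function.Injective fun s : G => (s * b, false) := by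
    intro x y h; simpa using h
  have himage : (fun s : G => (s * b, false)) '' (S0 ∪ {1}) = A := by
    refine eq_of_subset_of_ncard_le ?_ ?_
    · rintro _ ⟨s, hs | rfl, rfl⟩
      · exact hclosed s hs b hb
      · simpa using hb
    · rw [ncard_image_of_injective _ hinj, union_singleton, ncard_insert_of_notMem hS0]
      omega
  refine exists_subgroup_of_mul_mem (by simp) ?_
  rintro x (hx | rfl) y hy
  · have hyA : (y * b, false) ∈ A := himage ▸ mem_image_of_mem _ hy
    have hxy := hclosed x hx _ hyA
    rw [← himage, ← mul_assoc] at hxy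
    exact (hinj.mem_set_image).1 hxy
  · simpa using hy

theorem omegaPlus_subgroup_ncard [Finite G] {S0 T0 : Set G} (S1 T1 : Set G)
    (hS0 : (1 : G) ∉ S0) (hT0 : T0.ncard = 1) {H : Subgroup G} (hH : (H : Set G) = S0 ∪ {1}) :
    (omegaPlus (MDArc S0 S1 T0 T1) ((H : Set G) ×ˢ {false})).ncard = S0.ncard + 1 := by
  have hA : (H : Set G) ×ˢ {false} ⊆ {p : G × Bool | p.2 = false} := fun p hp => hp.2
  obtain ⟨hsub, hcard⟩ := crossArcs_subset_omegaPlus_and_ncard S0 S1 T0 T1 hA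
  have hHcard : ((H : Set G) ×ˢ {false}).ncard = S0.ncard + 1 := by
    rw [ncard_prod, ncard_singleton, mul_one, hH, union_singleton, ncard_insert_of_notMem hS0]
  rw [hHcard, hT0, mul_one] at hcard
  rw [← hcard]
  congr 1
  refine Subset.antisymm ?_ hsub
  rintro ⟨⟨g, i⟩, ⟨h, j⟩⟩ ⟨hR, ⟨hg, hi⟩, hout⟩
  obtain rfl : i = false := hi
  obtain ⟨-, hj, s, hs, e⟩ | ⟨hi, -⟩ | ⟨-, hj, t, ht, e⟩ | ⟨hi, -⟩ := hR
  · refine absurd ⟨?_, hj⟩ hout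
    have hsH : s ∈ (H : Set G) := hH ▸ Or.inl hs
    exact (show h = s * g from e) ▸ H.mul_mem hsH hg
  · simp at hi
  · obtain rfl : j = true := hj
    obtain rfl : h = t * g := e
    exact ⟨((g, false), t), ⟨⟨hg, rfl⟩, ht⟩, rfl⟩
  · simp at hi

theorem omegaMinus_swapSides (S0 S1 T0 T1 : Set G) (A : Set (G × Bool)) :
    (omegaMinus (MDArc S1 S0 T1⁻¹ T0⁻¹) (swapSides G '' A)).ncard =
      (omegaMinus (MDArc S0 S1 T0 T1) A).ncard := by
  rw [← omegaPlus_flip_ncard, ← omegaPlus_flip_ncard]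
  exact omegaPlus_ncard_image_equiv _ (fun u v => MDArc_swapSides S0 S1 T0 T1 v u) A

theorem subgroup_of_omegaPlus_or_omegaMinus_le [Finite G] {S0 S1 T0 T1 : Set G}
    (hS0 : (1 : G) ∉ S0) (hS1 : (1 : G) ∉ S1) (hT0 : T0.Nonempty) (hT1 : T1.Nonempty)
    {A : Set (G × Bool)} (hA : A ⊆ {p | p.2 = false}) (hA2 : 2 ≤ A.ncard)
    (h : (omegaPlus (MDArc S0 S1 T0 T1) A).ncard ≤
        min S0.ncard S1.ncard + min T0.ncard T1.ncard ∨
      (omegaMinus (MDArc S0 S1 T0 T1) A).ncard ≤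
        min S0.ncard S1.ncard + min T0.ncard T1.ncard) :
    (T0.ncard = 1 ∨ T1.ncard = 1) ∧ 1 ≤ S0.ncard ∧ S0.ncard ≤ S1.ncard ∧
      ∃ H : Subgroup G, (H : Set G) = S0 ∪ {1} := by
  rcases h with h | h
  · exact (subgroup_of_omegaPlus_le (T1 := T1) hS0 hS1 hT0 hA hA2 (by omega)
      (by omega)).imp_left Or.inl
  · rw [← omegaPlus_ncard_of_reverse (MDArc_reverse S0 S1 T0 T1)] at h
    have := subgroup_of_omegaPlus_le (S0 := S0⁻¹) (S1 := S1⁻¹) (T1 := T0)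
      (by simpa) (by simpa) hT1 hA hA2
      (by rw [ncard_inv_eq]; omega) (by rw [ncard_inv_eq]; omega)
    rw [ncard_inv_eq, ncard_inv_eq] at this
    exact ⟨Or.inr this.1, this.2.1, this.2.2.1, exists_subgroup_coe_inv_union_one this.2.2.2⟩

theorem exists_omegaPlus_or_omegaMinus_ncard_eq [Finite G] {S0 S1 T0 T1 : Set G}
    (hS0 : (1 : G) ∉ S0) (hT0 : T0.Nonempty) (hT1 : T1.Nonempty)
    (h : (T0.ncard = 1 ∨ T1.ncard = 1) ∧ 1 ≤ S0.ncard ∧ S0.ncard ≤ S1.ncard ∧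
      ∃ H : Subgroup G, (H : Set G) = S0 ∪ {1}) :
    ∃ A : Set (G × Bool), A ⊆ {p | p.2 = false} ∧ 2 ≤ A.ncard ∧
      A.ncard = min S0.ncard S1.ncard + min T0.ncard T1.ncard ∧
      ((omegaPlus (MDArc S0 S1 T0 T1) A).ncard =
          min S0.ncard S1.ncard + min T0.ncard T1.ncard ∨
        (omegaMinus (MDArc S0 S1 T0 T1) A).ncard =
          min S0.ncard S1.ncard + min T0.ncard T1.ncard) := by
  obtain ⟨hT, hpos, hle, H, hH⟩ := h
  have hHcard : ((H : Set G) ×ˢ {false}).ncard = S0.ncard + 1 := by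
    rw [ncard_prod, ncard_singleton, mul_one, hH, union_singleton, ncard_insert_of_notMem hS0]
  have h0 : 1 ≤ T0.ncard := hT0.ncard_pos
  have h1 : 1 ≤ T1.ncard := hT1.ncard_pos
  refine ⟨(H : Set G) ×ˢ {false}, fun p hp => hp.2, by omega, by omega, ?_⟩
  rcases hT with hT | hT
  · left
    rw [omegaPlus_subgroup_ncard S1 T1 hS0 hT hH]
    omega
  · right
    have hH' : (H : Set G) = S0⁻¹ ∪ {1} := by
      rw [← inv_coe_set (H := H), hH]
      simp
    rw [← omegaPlus_ncard_of_reverse (MDArc_reverse S0 S1 T0 T1),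
      omegaPlus_subgroup_ncard S1⁻¹ T0 (by simpa) hT hH', ncard_inv_eq]
    omega

theorem minDegree_le_ncard_of_isArcFragment [Finite G] {S0 S1 T0 T1 : Set G}
    (hS0 : (1 : G) ∉ S0) (hS1 : (1 : G) ∉ S1)
    (hmax : arcConnectivity (MDArc S0 S1 T0 T1) = minDegree (MDArc S0 S1 T0 T1))
    {B : Set (G × Bool)} (hB : IsArcFragment (MDArc S0 S1 T0 T1) B) (hB2 : 2 ≤ B.ncard) :
    minDegree (MDArc S0 S1 T0 T1) ≤ B.ncard := by
  rcases hB with hB | hB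
  · exact le_ncard_of_omegaPlus_ncard_le (MDArc_irrefl T0 T1 hS0 hS1)
      (fun v _ => Nat.sInf_le ⟨v, Or.inl rfl⟩) hB2 (hB.2.2.trans hmax).le
  · have hω := hB.2.2.trans hmax
    rw [← omegaPlus_flip_ncard] at hω
    exact le_ncard_of_omegaPlus_ncard_le (R := flip (MDArc S0 S1 T0 T1))
      (MDArc_irrefl T0 T1 hS0 hS1) (fun v _ => Nat.sInf_le ⟨v, Or.inr rfl⟩) hB2 hω.le

theorem isLambdaSuperatom_of_ncard_eq_minDegree [Finite G] {S0 S1 T0 T1 : Set G}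
    (hS0 : (1 : G) ∉ S0) (hS1 : (1 : G) ∉ S1)
    (hmax : arcConnectivity (MDArc S0 S1 T0 T1) = minDegree (MDArc S0 S1 T0 T1))
    {A : Set (G × Bool)} (hA : A ≠ univ) (hA2 : 2 ≤ A.ncard)
    (hcard : A.ncard = minDegree (MDArc S0 S1 T0 T1))
    (hω : (omegaPlus (MDArc S0 S1 T0 T1) A).ncard = minDegree (MDArc S0 S1 T0 T1) ∨
      (omegaMinus (MDArc S0 S1 T0 T1) A).ncard = minDegree (MDArc S0 S1 T0 T1)) :
    IsLambdaSuperatom (MDArc S0 S1 T0 T1) A := by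
  have hne : A.Nonempty := nonempty_of_ncard_ne_zero (by omega)
  rw [← hmax] at hω
  refine ⟨hω.imp (fun h => ⟨hne, hA, h⟩) (fun h => ⟨hne, hA, h⟩), hA2, fun B hB hB2 => ?_⟩
  rw [hcard]
  exact minDegree_le_ncard_of_isArcFragment hS0 hS1 hmax hB hB2

end MixedCayley

/-- `X` has a λ-superatom contained in `X_0` or in `X_1` iff one
of the two stated conditions holds. -/
theorem mixedCayley_superatom_in_one_side_iff
    {G : Type*} [Group G] [Fintype G] (S0 S1 T0 T1 : Set G)
    (hS0 : (1 : G) ∉ S0) (hS1 : (1 : G) ∉ S1)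
    (hT0 : T0.Nonempty) (hT1 : T1.Nonempty)
    (hsc : DigraphStronglyConnected (MDArc S0 S1 T0 T1))
    (hmax : arcConnectivity (MDArc S0 S1 T0 T1) = minDegree (MDArc S0 S1 T0 T1))
    (hnsuper : ¬ SuperLambda (MDArc S0 S1 T0 T1))
    (hndir : ¬ IsDirectedCycleDigraph (MDArc S0 S1 T0 T1))
    (hnbidir : ¬ IsBidirectedCycleDigraph (MDArc S0 S1 T0 T1))
    (hnF : ¬ InClassF S0 S1 T0 T1) :
    (∃ A : Set (G × Bool), IsLambdaSuperatom (MDArc S0 S1 T0 T1) A ∧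
        (A ⊆ {p : G × Bool | p.2 = false} ∨ A ⊆ {p : G × Bool | p.2 = true})) ↔
      (((T0.ncard = 1 ∨ T1.ncard = 1) ∧ 1 ≤ S0.ncard ∧ S0.ncard ≤ S1.ncard ∧
          ∃ H : Subgroup G, (H : Set G) = S0 ∪ {1}) ∨
        ((T0.ncard = 1 ∨ T1.ncard = 1) ∧ 1 ≤ S1.ncard ∧ S1.ncard ≤ S0.ncard ∧
          ∃ H : Subgroup G, (H : Set G) = S1 ∪ {1})) := by
  have hdeg := minDegree_MDArc S0 S1 T0 T1
  constructor
  · rintro ⟨A, ⟨hfrag, hA2, -⟩, hA⟩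
    have hω : (omegaPlus (MDArc S0 S1 T0 T1) A).ncard ≤
          min S0.ncard S1.ncard + min T0.ncard T1.ncard ∨
        (omegaMinus (MDArc S0 S1 T0 T1) A).ncard ≤
          min S0.ncard S1.ncard + min T0.ncard T1.ncard := by
      rw [← hdeg, ← hmax]
      exact hfrag.imp (fun h => h.2.2.le) (fun h => h.2.2.le)
    rcases hA with hA | hA
    · exact Or.inl (subgroup_of_omegaPlus_or_omegaMinus_le hS0 hS1 hT0 hT1 hA hA2 hω)
    · right
      rw [← omegaPlus_ncard_image_equiv _ (MDArc_swapSides S0 S1 T0 T1),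
        ← omegaMinus_swapSides, min_comm S0.ncard, min_comm T0.ncard, ← ncard_inv_eq T0,
        ← ncard_inv_eq T1] at hω
      have := subgroup_of_omegaPlus_or_omegaMinus_le hS1 hS0 hT1.inv hT0.inv
        (by
          rintro _ ⟨⟨g, i⟩, hu, rfl⟩
          obtain rfl : i = true := hA hu
          rfl)
        (by rwa [ncard_image_of_injective _ (swapSides G).injective]) hω
      rw [ncard_inv_eq, ncard_inv_eq] at this
      exact this.imp_left Or.symm
  · rintro (h | h)
    · obtain ⟨A, hA, hA2, hcard, hω⟩ := exists_omegaPlus_or_omegaMinus_ncard_eq hS0 hT0 hT1 h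
      rw [← hdeg] at hcard hω
      refine ⟨A, isLambdaSuperatom_of_ncard_eq_minDegree hS0 hS1 hmax ?_ hA2 hcard hω,
        Or.inl hA⟩
      rintro rfl
      simpa using hA (mem_univ ((1 : G), true))
    · rw [or_comm, ← ncard_inv_eq T0, ← ncard_inv_eq T1] at h
      obtain ⟨A, hA, hA2, hcard, hω⟩ :=
        exists_omegaPlus_or_omegaMinus_ncard_eq hS1 hT1.inv hT0.inv h
      obtain ⟨B, rfl⟩ : ∃ B, swapSides G '' B = A :=
        ⟨swapSides G ⁻¹' A, image_preimage_eq A (swapSides G).surjective⟩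
      rw [ncard_image_of_injective _ (swapSides G).injective] at hcard hA2
      rw [omegaPlus_ncard_image_equiv _ (MDArc_swapSides S0 S1 T0 T1),
        omegaMinus_swapSides] at hω
      rw [ncard_inv_eq, ncard_inv_eq, min_comm S1.ncard, min_comm T1.ncard, ← hdeg] at hcard hω
      have hB : B ⊆ {p | p.2 = true} := by
        rintro ⟨g, i⟩ hu
        have : (!i) = false := hA (mem_image_of_mem _ hu)
        simpa using this
      refine ⟨B, isLambdaSuperatom_of_ncard_eq_minDegree hS0 hS1 hmax ?_ hA2 hcard hω,
        Or.inr hB⟩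
      rintro rfl
      simpa using hB (mem_univ ((1 : G), false))
end
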